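/- Let h be a positive integer and let P ⊂ ℝ² be a minimal lattice polygon with ls_□(P) = h. Then P is lattice-equivalent to one of the following: (a) the segment I = [(0,0), (h,0)]; (b) a triangle conv{(0,0), (a,h), (h,b)} where a, b are integers with 1 ≤ a, b ≤ h−1 and a + b ≥ h; (c) a quadrilateral conv{(a,0), (0,b), (h,h−c), (h−d,h)} where a, b, c, d are integers with 1 ≤ a, b, c, d ≤ h−1 and min{a,b} + min{c,d} > h. -/

import Mathlib

open Set MeasureTheory Pointwise

/-- A plane convex body: a compact convex subset of ℝ² with nonempty interior. -/
def IsPlaneConvexBody (P : Set (Fin 2 → ℝ)) : Prop :=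
  IsCompact P ∧ Convex ℝ P ∧ (interior P).Nonempty

/-- The width of `P` in the direction `u`. -/
noncomputable def width (P : Set (Fin 2 → ℝ)) (u : Fin 2 → ℝ) : ℝ :=
  sSup ((fun p => u 0 * p 0 + u 1 * p 1) '' P) -
    sInf ((fun p => u 0 * p 0 + u 1 * p 1) '' P)

/-- An affine unimodular transformation: multiplication by an integer matrix with
determinant `±1` followed by a translation by an integer vector. -/
def IsUnimodularMap (φ : (Fin 2 → ℝ) → (Fin 2 → ℝ)) : Prop :=
  ∃ (A : Matrix (Fin 2) (Fin 2) ℤ) (t : Fin 2 → ℤ),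
    (A.det = 1 ∨ A.det = -1) ∧
    ∀ x, φ x = (A.map (Int.cast : ℤ → ℝ)).mulVec x + fun i => (t i : ℝ)

/-- Two subsets of ℝ² are lattice-equivalent if one is the image of the other
under an affine unimodular transformation. -/
def LatticeEquivalent (P Q : Set (Fin 2 → ℝ)) : Prop :=
  ∃ φ, IsUnimodularMap φ ∧ Q = φ '' P

/-- The `l`-dilate of the unit square, `[0,l]²`. -/
def squareDilate (l : ℝ) : Set (Fin 2 → ℝ) :=
  {x | ∀ i, x i ∈ Set.Icc 0 l}

/-- The `l`-dilate of the standard 2-simplex. -/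
def simplexDilate (l : ℝ) : Set (Fin 2 → ℝ) :=
  {x | 0 ≤ x 0 ∧ 0 ≤ x 1 ∧ x 0 + x 1 ≤ l}

/-- The lattice size of `P` with respect to the unit square. -/
noncomputable def lsSquare (P : Set (Fin 2 → ℝ)) : ℝ :=
  sInf {l : ℝ | 0 ≤ l ∧ ∃ φ, IsUnimodularMap φ ∧ φ '' P ⊆ squareDilate l}

/-- The lattice size of `P` with respect to the standard simplex. -/
noncomputable def lsDelta (P : Set (Fin 2 → ℝ)) : ℝ :=
  sInf {l : ℝ | 0 ≤ l ∧ ∃ φ, IsUnimodularMap φ ∧ φ '' P ⊆ simplexDilate l}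

/-- The lattice width of `P`: the minimum of `width P u` over primitive integer
directions `u`. -/
noncomputable def latticeWidth (P : Set (Fin 2 → ℝ)) : ℝ :=
  sInf {w : ℝ | ∃ u : Fin 2 → ℤ, Int.gcd (u 0) (u 1) = 1 ∧
    w = width P (fun i => (u i : ℝ))}

/-- A lattice polygon: the convex hull of a (nonempty) finite set of points of ℤ². -/
def IsLatticePolygon (P : Set (Fin 2 → ℝ)) : Prop :=
  ∃ S : Finset (Fin 2 → ℤ), S.Nonempty ∧
    P = convexHull ℝ ((fun p : Fin 2 → ℤ => fun i => (p i : ℝ)) '' (S : Set (Fin 2 → ℤ)))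

/-- The area of a plane set: its two-dimensional Lebesgue measure. -/
noncomputable def area (P : Set (Fin 2 → ℝ)) : ℝ :=
  (volume P).toReal

/-- The real point attached to a pair of integers. -/
def pt (z : ℤ × ℤ) : Fin 2 → ℝ := ![(z.1 : ℝ), (z.2 : ℝ)]

@[simp] lemma pt_zero (z : ℤ × ℤ) : pt z 0 = z.1 := rfl
@[simp] lemma pt_one (z : ℤ × ℤ) : pt z 1 = z.2 := rfl

/-- An integer affine map written in coordinates. -/
def aff (a b c d s t : ℤ) (x : Fin 2 → ℝ) : Fin 2 → ℝ :=
  ![a * x 0 + b * x 1 + s, c * x 0 + d * x 1 + t]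

@[simp] lemma aff_zero (a b c d s t : ℤ) (x : Fin 2 → ℝ) :
    aff a b c d s t x 0 = a * x 0 + b * x 1 + s := rfl
@[simp] lemma aff_one (a b c d s t : ℤ) (x : Fin 2 → ℝ) :
    aff a b c d s t x 1 = c * x 0 + d * x 1 + t := rfl

lemma vec_ext {x y : Fin 2 → ℝ} (h0 : x 0 = y 0) (h1 : x 1 = y 1) : x = y := by
  ext i; fin_cases i
  · exact h0
  · exact h1

lemma aff_pt (a b c d s t : ℤ) (z : ℤ × ℤ) :
    aff a b c d s t (pt z) = pt (a * z.1 + b * z.2 + s, c * z.1 + d * z.2 + t) := by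
  apply vec_ext <;> simp

lemma aff_uni {a b c d : ℤ} (s t : ℤ) (hd : a * d - b * c = 1 ∨ a * d - b * c = -1) :
    IsUnimodularMap (aff a b c d s t) := by
  refine ⟨!![a, b; c, d], ![s, t], ?_, ?_⟩
  · rw [Matrix.det_fin_two_of]; exact hd
  · intro x
    apply vec_ext <;> simp

lemma uni_aff {φ : (Fin 2 → ℝ) → (Fin 2 → ℝ)} (h : IsUnimodularMap φ) :
    ∃ a b c d s t : ℤ, (a * d - b * c = 1 ∨ a * d - b * c = -1) ∧ φ = aff a b c d s t := by
  obtain ⟨A, t, hA, hφ⟩ := h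
  refine ⟨A 0 0, A 0 1, A 1 0, A 1 1, t 0, t 1, ?_, ?_⟩
  · rw [Matrix.det_fin_two] at hA; exact hA
  · funext x
    rw [hφ x]
    apply vec_ext <;> simp

lemma aff_comp (a b c d s t a' b' c' d' s' t' : ℤ) (x : Fin 2 → ℝ) :
    aff a b c d s t (aff a' b' c' d' s' t' x) =
      aff (a * a' + b * c') (a * b' + b * d') (c * a' + d * c') (c * b' + d * d')
        (a * s' + b * t' + s) (c * s' + d * t' + t) x := by
  apply vec_ext <;> simp <;> ring

lemma uni_comp {φ ψ : (Fin 2 → ℝ) → (Fin 2 → ℝ)} (h : IsUnimodularMap φ)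
    (h' : IsUnimodularMap ψ) : IsUnimodularMap (φ ∘ ψ) := by
  obtain ⟨a, b, c, d, s, t, hd, rfl⟩ := uni_aff h
  obtain ⟨a', b', c', d', s', t', hd', rfl⟩ := uni_aff h'
  have : aff a b c d s t ∘ aff a' b' c' d' s' t' = _ :=
    funext (fun x => aff_comp a b c d s t a' b' c' d' s' t' x)
  rw [this]
  apply aff_uni
  have e : (a * a' + b * c') * (c * b' + d * d') - (a * b' + b * d') * (c * a' + d * c')
    = (a * d - b * c) * (a' * d' - b' * c') := by ring
  rw [e]
  rcases hd with hd | hd <;> rcases hd' with hd' | hd' <;> rw [hd, hd'] <;> simp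

lemma uni_inv {φ : (Fin 2 → ℝ) → (Fin 2 → ℝ)} (h : IsUnimodularMap φ) :
    ∃ ψ, IsUnimodularMap ψ ∧ (∀ x, ψ (φ x) = x) ∧ (∀ x, φ (ψ x) = x) := by
  obtain ⟨a, b, c, d, s, t, hd, rfl⟩ := uni_aff h
  obtain ⟨D, hD⟩ : ∃ D, D = a * d - b * c := ⟨_, rfl⟩
  have hDD : D * D = 1 := by rw [← hD] at hd; rcases hd with hd | hd <;> rw [hd] <;> norm_num
  have hR : (D : ℝ) * (a * d - b * c) = 1 := by rw [hD] at hDD; rw [hD]; exact_mod_cast hDD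
  refine ⟨aff (D * d) (-(D * b)) (-(D * c)) (D * a) (-(D * d * s) + D * b * t)
    (D * c * s - D * a * t), ?_, ?_, ?_⟩
  · apply aff_uni
    have e : D * d * (D * a) - -(D * b) * -(D * c) = (D * D) * (a * d - b * c) := by ring
    rw [e, hDD, one_mul]; exact hd
  · intro x
    apply vec_ext
    · simp
      linear_combination (x 0) * hR
    · simp
      linear_combination (x 1) * hR
  · intro x
    apply vec_ext
    · simp
      linear_combination (x 0 - s) * hR
    · simp
      linear_combination (x 1 - t) * hR

lemma aff_convexHull (a b c d s t : ℤ) (S : Set (Fin 2 → ℝ)) :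
    aff a b c d s t '' convexHull ℝ S = convexHull ℝ (aff a b c d s t '' S) := by
  let f : (Fin 2 → ℝ) →ᵃ[ℝ] (Fin 2 → ℝ) :=
    (Matrix.mulVecLin !![(a : ℝ), b; c, d]).toAffineMap +
      AffineMap.const ℝ (Fin 2 → ℝ) ![(s : ℝ), t]
  have hf : (f : (Fin 2 → ℝ) → (Fin 2 → ℝ)) = aff a b c d s t := by
    funext x
    apply vec_ext <;> simp [f, dotProduct, Fin.sum_univ_two]
  rw [← hf]
  exact f.image_convexHull S

lemma poly_iff (P : Set (Fin 2 → ℝ)) : IsLatticePolygon P ↔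
    ∃ S : Finset (ℤ × ℤ), S.Nonempty ∧ P = convexHull ℝ (pt '' (S : Set (ℤ × ℤ))) := by
  classical
  constructor
  · rintro ⟨S, hS, rfl⟩
    refine ⟨S.image (fun p => (p 0, p 1)), hS.image _, ?_⟩
    congr 1
    rw [Finset.coe_image, Set.image_image]
    apply Set.image_congr
    intro p _
    apply vec_ext <;> simp
  · rintro ⟨S, hS, rfl⟩
    refine ⟨S.image (fun p => ![p.1, p.2]), hS.image _, ?_⟩
    congr 1
    rw [Finset.coe_image, Set.image_image]
    apply Set.image_congr
    intro p _
    apply vec_ext <;> simp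

lemma poly_image {P : Set (Fin 2 → ℝ)} (hP : IsLatticePolygon P)
    {φ : (Fin 2 → ℝ) → (Fin 2 → ℝ)} (h : IsUnimodularMap φ) : IsLatticePolygon (φ '' P) := by
  classical
  obtain ⟨a, b, c, d, s, t, hd, rfl⟩ := uni_aff h
  rw [poly_iff] at hP ⊢
  obtain ⟨S, hS, rfl⟩ := hP
  refine ⟨S.image (fun z => (a * z.1 + b * z.2 + s, c * z.1 + d * z.2 + t)), hS.image _, ?_⟩
  rw [aff_convexHull, Finset.coe_image, Set.image_image, Set.image_image]
  congr 1
  apply Set.image_congr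
  intro z _
  exact aff_pt ..

lemma ls_image_set {P : Set (Fin 2 → ℝ)} {φ : (Fin 2 → ℝ) → (Fin 2 → ℝ)}
    (h : IsUnimodularMap φ) : lsSquare (φ '' P) = lsSquare P := by
  obtain ⟨ψ, hψ, h1, h2⟩ := uni_inv h
  unfold lsSquare
  congr 1
  ext l
  constructor
  · rintro ⟨hl, χ, hχ, hs⟩
    refine ⟨hl, χ ∘ φ, uni_comp hχ h, ?_⟩
    rwa [Set.image_comp]
  · rintro ⟨hl, χ, hχ, hs⟩
    refine ⟨hl, χ ∘ ψ, uni_comp hχ hψ, ?_⟩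
    rw [Set.image_comp, Set.image_image ψ φ]
    simpa [h1] using hs

/-- `P` is a minimal lattice polygon of lattice size `h`. -/
def Minl (h : ℤ) (P : Set (Fin 2 → ℝ)) : Prop :=
  IsLatticePolygon P ∧ lsSquare P = (h : ℝ) ∧
    ∀ P' : Set (Fin 2 → ℝ), IsLatticePolygon P' → P' ⊂ P → lsSquare P' ≠ (h : ℝ)

/-- The conclusion of the classification. -/
def Concl (h : ℤ) (P : Set (Fin 2 → ℝ)) : Prop :=
    LatticeEquivalent P (convexHull ℝ {(![0, 0] : Fin 2 → ℝ), ![(h : ℝ), 0]}) ∨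
    (∃ a b : ℤ, 1 ≤ a ∧ a ≤ h - 1 ∧ 1 ≤ b ∧ b ≤ h - 1 ∧ h ≤ a + b ∧
      LatticeEquivalent P (convexHull ℝ
        {(![0, 0] : Fin 2 → ℝ), ![(a : ℝ), (h : ℝ)], ![(h : ℝ), (b : ℝ)]})) ∨
    (∃ a b c d : ℤ, 1 ≤ a ∧ a ≤ h - 1 ∧ 1 ≤ b ∧ b ≤ h - 1 ∧
      1 ≤ c ∧ c ≤ h - 1 ∧ 1 ≤ d ∧ d ≤ h - 1 ∧ h < min a b + min c d ∧
      LatticeEquivalent P (convexHull ℝ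
        {(![(a : ℝ), 0] : Fin 2 → ℝ), ![0, (b : ℝ)],
          ![(h : ℝ), ((h - c : ℤ) : ℝ)], ![((h - d : ℤ) : ℝ), (h : ℝ)]}))

lemma Minl.image {h : ℤ} {P : Set (Fin 2 → ℝ)} (hP : Minl h P)
    {φ : (Fin 2 → ℝ) → (Fin 2 → ℝ)} (hφ : IsUnimodularMap φ) : Minl h (φ '' P) := by
  obtain ⟨h1, h2, h3⟩ := hP
  refine ⟨poly_image h1 hφ, by rw [ls_image_set hφ, h2], ?_⟩
  intro P' hP' hsub hls
  obtain ⟨ψ, hψ, e1, e2⟩ := uni_inv hφ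
  have hid : φ '' (ψ '' P') = P' := by rw [Set.image_image]; simp [e2]
  have hid' : ψ '' (φ '' P) = P := by rw [Set.image_image]; simp [e1]
  refine h3 (ψ '' P') (poly_image hP' hψ) ?_ (by rw [ls_image_set hψ, hls])
  constructor
  · have := Set.image_mono (f := ψ) hsub.1
    rwa [hid'] at this
  · intro hc
    apply hsub.2
    have := Set.image_mono (f := φ) hc
    rwa [hid] at this

lemma LE.of_image {P Q : Set (Fin 2 → ℝ)} {φ : (Fin 2 → ℝ) → (Fin 2 → ℝ)}
    (hφ : IsUnimodularMap φ) (h : LatticeEquivalent (φ '' P) Q) : LatticeEquivalent P Q := by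
  obtain ⟨ψ, hψ, e⟩ := h
  exact ⟨ψ ∘ φ, uni_comp hψ hφ, by rw [e, Set.image_comp]⟩

lemma LE.refl' (P : Set (Fin 2 → ℝ)) : LatticeEquivalent P P := by
  refine ⟨aff 1 0 0 1 0 0, aff_uni _ _ (by norm_num), ?_⟩
  have : aff 1 0 0 1 0 0 = id := by
    funext x; apply vec_ext <;> simp
  rw [this]; simp

lemma Concl.of_image {h : ℤ} {P : Set (Fin 2 → ℝ)} {φ : (Fin 2 → ℝ) → (Fin 2 → ℝ)}
    (hφ : IsUnimodularMap φ) (hc : Concl h (φ '' P)) : Concl h P := by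
  rcases hc with hc | ⟨a, b, h1, h2, h3, h4, h5, hc⟩ |
    ⟨a, b, c, d, h1, h2, h3, h4, h5, h6, h7, h8, h9, hc⟩
  · exact Or.inl (LE.of_image hφ hc)
  · exact Or.inr (Or.inl ⟨a, b, h1, h2, h3, h4, h5, LE.of_image hφ hc⟩)
  · exact Or.inr (Or.inr ⟨a, b, c, d, h1, h2, h3, h4, h5, h6, h7, h8, h9, LE.of_image hφ hc⟩)

/-- Criterion guaranteeing lattice size at least `h`. -/
def Crit (h : ℤ) (F : Finset (ℤ × ℤ)) : Prop :=
  ∃ e f : ℤ, (e ≠ 0 ∨ f ≠ 0) ∧ ∀ u v : ℤ, u * f ≠ v * e →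
    ∃ p ∈ F, ∃ q ∈ F, h ≤ u * (p.1 - q.1) + v * (p.2 - q.2)

lemma Minl.eq_hull {h : ℤ} (hh : 0 < h) {P : Set (Fin 2 → ℝ)} (hP : Minl h P)
    {F : Finset (ℤ × ℤ)} (hne : F.Nonempty) (hF : ∀ z ∈ F, pt z ∈ P) (hc : Crit h F) :
    P = convexHull ℝ (pt '' (F : Set (ℤ × ℤ))) := by
  obtain ⟨h1, h2, h3⟩ := hP
  have hconv : Convex ℝ P := by
    obtain ⟨S, _, rfl⟩ := h1; exact convex_convexHull ℝ _
  have hsub : convexHull ℝ (pt '' (F : Set (ℤ × ℤ))) ⊆ P := by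
    apply convexHull_min _ hconv
    rintro _ ⟨z, hz, rfl⟩
    exact hF z hz
  by_contra hne'
  have hss : convexHull ℝ (pt '' (F : Set (ℤ × ℤ))) ⊂ P :=
    ⟨hsub, fun hc => hne' (Set.Subset.antisymm hc hsub)⟩
  refine h3 _ ((poly_iff _).2 ⟨F, hne, rfl⟩) hss ?_
  have hpos : (0 : ℝ) < h := by exact_mod_cast hh
  have hnon : {l : ℝ | 0 ≤ l ∧ ∃ φ, IsUnimodularMap φ ∧ φ '' P ⊆ squareDilate l}.Nonempty := by
    by_contra hemp
    rw [Set.not_nonempty_iff_eq_empty] at hemp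
    unfold lsSquare at h2
    rw [hemp, Real.sInf_empty] at h2
    linarith
  have hincl : {l : ℝ | 0 ≤ l ∧ ∃ φ, IsUnimodularMap φ ∧ φ '' P ⊆ squareDilate l} ⊆
      {l : ℝ | 0 ≤ l ∧ ∃ φ, IsUnimodularMap φ ∧
        φ '' (convexHull ℝ (pt '' (F : Set (ℤ × ℤ)))) ⊆ squareDilate l} := by
    rintro l ⟨hl, φ, hφ, hs⟩
    exact ⟨hl, φ, hφ, (Set.image_mono hsub).trans hs⟩
  apply le_antisymm
  · rw [← h2]
    exact csInf_le_csInf ⟨0, fun l hl => hl.1⟩ hnon hincl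
  · apply le_csInf (hnon.mono hincl)
    rintro l ⟨hl, φ, hφ, hs⟩
    obtain ⟨a, b, c, d, s, t, hd, rfl⟩ := uni_aff hφ
    obtain ⟨e, f, hef, hcr⟩ := hc
    have hmem : ∀ p ∈ F, aff a b c d s t (pt p) ∈ squareDilate l := by
      intro p hp
      apply hs
      exact ⟨pt p, subset_convexHull ℝ _ ⟨p, hp, rfl⟩, rfl⟩
    by_cases h0 : a * f = b * e
    · by_cases h1 : c * f = d * e
      · exfalso
        have e1 : (a * d - b * c) * e = 0 := by linear_combination c * h0 - a * h1
        have e2 : (a * d - b * c) * f = 0 := by linear_combination d * h0 - b * h1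
        have hD : a * d - b * c ≠ 0 := by omega
        rcases hef with h | h
        · exact (mul_ne_zero hD h) e1
        · exact (mul_ne_zero hD h) e2
      · obtain ⟨p, hp, q, hq, hle⟩ := hcr c d h1
        have m1 := (hmem p hp 1).2
        have m2 := (hmem q hq 1).1
        simp at m1 m2
        have : (h : ℝ) ≤ c * (p.1 - q.1) + d * (p.2 - q.2) := by exact_mod_cast hle
        linarith
    · obtain ⟨p, hp, q, hq, hle⟩ := hcr a b h0
      have m1 := (hmem p hp 0).2
      have m2 := (hmem q hq 0).1
      simp at m1 m2
      have : (h : ℝ) ≤ a * (p.1 - q.1) + b * (p.2 - q.2) := by exact_mod_cast hle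
      linarith

lemma hull_le {F : Set (ℤ × ℤ)} (u v k : ℤ) (hF : ∀ z ∈ F, u * z.1 + v * z.2 ≤ k) :
    ∀ x ∈ convexHull ℝ (pt '' F), (u : ℝ) * x 0 + v * x 1 ≤ k := by
  have hcv : Convex ℝ {x : Fin 2 → ℝ | (u : ℝ) * x 0 + v * x 1 ≤ k} := by
    intro x hx y hy a b ha hb hab
    simp only [Set.mem_ofPred_eq, Pi.add_apply, Pi.smul_apply, smul_eq_mul] at *
    have : (k : ℝ) = a * k + b * k := by rw [← add_mul, hab, one_mul]
    rw [this]
    nlinarith [mul_le_mul_of_nonneg_left hx ha, mul_le_mul_of_nonneg_left hy hb]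
  intro x hx
  refine convexHull_min ?_ hcv hx
  rintro _ ⟨z, hz, rfl⟩
  have := hF z hz
  simp only [Set.mem_ofPred_eq, pt_zero, pt_one]
  exact_mod_cast this

lemma exists_ext {P : Set (Fin 2 → ℝ)} (hP : IsLatticePolygon P) (u v : ℤ) :
    ∃ z : ℤ × ℤ, pt z ∈ P ∧
      ∀ x ∈ P, (u : ℝ) * x 0 + v * x 1 ≤ ((u * z.1 + v * z.2 : ℤ) : ℝ) := by
  obtain ⟨S, hS, rfl⟩ := (poly_iff P).1 hP
  obtain ⟨z, hz, hmax⟩ := S.exists_max_image (fun z => u * z.1 + v * z.2) hS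
  exact ⟨z, subset_convexHull ℝ _ ⟨z, hz, rfl⟩, hull_le u v _ hmax⟩

lemma Minl.lower {h : ℤ} {P : Set (Fin 2 → ℝ)} (hP : Minl h P) (a b c d : ℤ)
    (hd : a * d - b * c = 1 ∨ a * d - b * c = -1) :
    (∃ p q : ℤ × ℤ, pt p ∈ P ∧ pt q ∈ P ∧ h ≤ a * (p.1 - q.1) + b * (p.2 - q.2)) ∨
    (∃ p q : ℤ × ℤ, pt p ∈ P ∧ pt q ∈ P ∧ h ≤ c * (p.1 - q.1) + d * (p.2 - q.2)) := by
  by_contra hcon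
  push Not at hcon
  obtain ⟨hc1, hc2⟩ := hcon
  obtain ⟨p, hp, hp'⟩ := exists_ext hP.1 a b
  obtain ⟨q, hq, hq'⟩ := exists_ext hP.1 (-a) (-b)
  obtain ⟨p2, hp2, hp2'⟩ := exists_ext hP.1 c d
  obtain ⟨q2, hq2, hq2'⟩ := exists_ext hP.1 (-c) (-d)
  have k1 := hc1 p q hp hq
  have k2 := hc2 p2 q2 hp2 hq2
  have k0 := hc1 p p hp hp
  simp only [sub_self, mul_zero, add_zero] at k0
  have hle : lsSquare P ≤ ((h - 1 : ℤ) : ℝ) := by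
    apply csInf_le ⟨0, fun l hl => hl.1⟩
    refine ⟨by exact_mod_cast (by omega), aff a b c d (-(a * q.1 + b * q.2))
      (-(c * q2.1 + d * q2.2)), aff_uni _ _ hd, ?_⟩
    rintro _ ⟨x, hx, rfl⟩
    have k1' : ((a * (p.1 - q.1) + b * (p.2 - q.2) : ℤ) : ℝ) ≤ ((h - 1 : ℤ) : ℝ) := by
      exact_mod_cast (by omega)
    have k2' : ((c * (p2.1 - q2.1) + d * (p2.2 - q2.2) : ℤ) : ℝ) ≤ ((h - 1 : ℤ) : ℝ) := by
      exact_mod_cast (by omega)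
    have e1 := hp' x hx
    have e2 := hq' x hx
    have e3 := hp2' x hx
    have e4 := hq2' x hx
    push_cast at *
    intro i
    fin_cases i
    · simp only [Fin.zero_eta, aff_zero, Set.mem_Icc]
      push_cast
      constructor <;> linarith
    · simp only [Fin.mk_one, aff_one, Set.mem_Icc]
      push_cast
      constructor <;> linarith
  rw [hP.2.1] at hle
  have : h ≤ h - 1 := by exact_mod_cast hle
  omega

lemma Minl.exists_box {h : ℤ} (hh : 0 < h) {P : Set (Fin 2 → ℝ)} (hP : Minl h P) :
    ∃ φ, IsUnimodularMap φ ∧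
      ∀ x ∈ φ '' P, 0 ≤ x 0 ∧ x 0 ≤ h ∧ 0 ≤ x 1 ∧ x 1 ≤ h := by
  have hpos : (0 : ℝ) < h := by exact_mod_cast hh
  have h2 := hP.2.1
  have hnon : {l : ℝ | 0 ≤ l ∧ ∃ φ, IsUnimodularMap φ ∧ φ '' P ⊆ squareDilate l}.Nonempty := by
    by_contra hemp
    rw [Set.not_nonempty_iff_eq_empty] at hemp
    unfold lsSquare at h2
    rw [hemp, Real.sInf_empty] at h2
    linarith
  have hlt : lsSquare P < h + 1 := by rw [h2]; linarith
  obtain ⟨l, ⟨hl, φ, hφ, hs⟩, hl'⟩ := exists_lt_of_csInf_lt hnon hlt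
  refine ⟨φ, hφ, ?_⟩
  have hL := (poly_image hP.1 hφ)
  intro x hx
  have hx' := hs hx
  have key : ∀ z : ℤ × ℤ, pt z ∈ φ '' P → z.1 ≤ h ∧ z.2 ≤ h := by
    intro z hz
    have := hs hz
    have a0 := (this 0).2
    have a1 := (this 1).2
    simp at a0 a1
    have b0 : (z.1 : ℝ) < ((h + 1 : ℤ) : ℝ) := by push_cast; linarith
    have b1 : (z.2 : ℝ) < ((h + 1 : ℤ) : ℝ) := by push_cast; linarith
    have b0' : z.1 < h + 1 := by exact_mod_cast b0
    have b1' : z.2 < h + 1 := by exact_mod_cast b1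
    omega
  obtain ⟨z, hz, hzm⟩ := exists_ext hL 1 0
  obtain ⟨w, hw, hwm⟩ := exists_ext hL 0 1
  have e1 := hzm x hx
  have e2 := hwm x hx
  have f1 : (z.1 : ℝ) ≤ h := by exact_mod_cast (key z hz).1
  have f2 : (w.2 : ℝ) ≤ h := by exact_mod_cast (key w hw).2
  push_cast at e1 e2
  exact ⟨(hx' 0).1, by linarith, (hx' 1).1, by linarith⟩

lemma Minl.convex {h : ℤ} {P : Set (Fin 2 → ℝ)} (hP : Minl h P) : Convex ℝ P := by
  obtain ⟨⟨S, _, rfl⟩, _⟩ := hP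
  exact convex_convexHull ℝ _

lemma img {P : Set (Fin 2 → ℝ)} {z w : ℤ × ℤ} {a b c d s t : ℤ} (hz : pt z ∈ P)
    (e1 : a * z.1 + b * z.2 + s = w.1) (e2 : c * z.1 + d * z.2 + t = w.2) :
    pt w ∈ aff a b c d s t '' P := by
  refine ⟨pt z, hz, ?_⟩
  rw [aff_pt, e1, e2]

/-- Points on the vertical segment between a point of `P` and a chord of `P`. -/
lemma vert {P : Set (Fin 2 → ℝ)} (hc : Convex ℝ P) {h p q x y y' : ℤ} (hh : 0 < h)
    (h0 : pt (0, p) ∈ P) (h1 : pt (h, q) ∈ P) (h2 : pt (x, y) ∈ P) (hx0 : 0 ≤ x) (hxh : x ≤ h)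
    (hy : (y' ≤ y ∧ h * p + (q - p) * x ≤ h * y') ∨ (y ≤ y' ∧ h * y' ≤ h * p + (q - p) * x)) :
    pt (x, y') ∈ P := by
  have hpos : (0 : ℝ) < h := by exact_mod_cast hh
  have hx0' : (0 : ℝ) ≤ x := by exact_mod_cast hx0
  have hxh' : (x : ℝ) ≤ h := by exact_mod_cast hxh
  have hm : (![(x : ℝ), p + (q - p) * (x / h)] : Fin 2 → ℝ) ∈ P := by
    have := hc h0 h1 (a := 1 - x / h) (b := x / h)
      (by rw [sub_nonneg, div_le_one hpos]; exact hxh') (by positivity) (by ring)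
    convert this using 1
    apply vec_ext
    · simp; field_simp
    · simp; ring
  have hcv : Convex ℝ {r : ℝ | (![(x : ℝ), r] : Fin 2 → ℝ) ∈ P} := by
    intro r hr r' hr' a b ha hb hab
    have := hc hr hr' ha hb hab
    simp only [Set.mem_ofPred_eq]
    convert this using 1
    apply vec_ext
    · simp; rw [← add_mul, hab, one_mul]
    · simp
  have hord := hcv.ordConnected
  have hlin : (h : ℝ) * (p + (q - p) * (x / h)) = h * p + (q - p) * x := by field_simp
  rcases hy with ⟨ha, hb⟩ | ⟨ha, hb⟩
  · have ha' : (y' : ℝ) ≤ y := by exact_mod_cast ha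
    have hb' : (h : ℝ) * p + (q - p) * x ≤ h * y' := by exact_mod_cast hb
    exact hord.out hm h2 ⟨le_of_mul_le_mul_left (by linarith) hpos, ha'⟩
  · have ha' : (y : ℝ) ≤ y' := by exact_mod_cast ha
    have hb' : (h : ℝ) * y' ≤ h * p + (q - p) * x := by exact_mod_cast hb
    exact hord.out h2 hm ⟨ha', le_of_mul_le_mul_left (by linarith) hpos⟩

lemma critA {h : ℤ} (hh : 0 < h) {F : Finset (ℤ × ℤ)}
    (hx : ∀ p ∈ F, ∀ q ∈ F, p.1 - q.1 ≤ h) (hy : ∀ p ∈ F, ∀ q ∈ F, p.2 - q.2 ≤ h)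
    (h1 : ∃ p ∈ F, ∃ q ∈ F, h ≤ p.1 - q.1)
    (h2 : ∃ p ∈ F, ∃ q ∈ F, h ≤ (p.1 - q.1) + (p.2 - q.2))
    (h3 : ∃ p ∈ F, ∃ q ∈ F, h ≤ (p.1 - q.1) - (p.2 - q.2)) : Crit h F := by
  refine ⟨0, 1, Or.inr one_ne_zero, ?_⟩
  intro u v huv
  have hu : u ≠ 0 := by simpa using huv
  clear huv
  -- reduce to u > 0
  have key : ∀ u v : ℤ, 0 < u → ∃ p ∈ F, ∃ q ∈ F, h ≤ u * (p.1 - q.1) + v * (p.2 - q.2) := by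
    intro u v hu
    rcases lt_trichotomy v 0 with hv | hv | hv
    · obtain ⟨p, hp, q, hq, hle⟩ := h3
      refine ⟨p, hp, q, hq, ?_⟩
      have a1 := hx p hp q hq
      have a2 := hy q hq p hp
      have b1 : 0 ≤ p.1 - q.1 := by omega
      have b2 : 0 ≤ q.2 - p.2 := by omega
      nlinarith [mul_nonneg (by omega : 0 ≤ u - 1) b1, mul_nonneg (by omega : 0 ≤ -v - 1) b2]
    · obtain ⟨p, hp, q, hq, hle⟩ := h1
      refine ⟨p, hp, q, hq, ?_⟩
      subst hv
      nlinarith [mul_nonneg (by omega : 0 ≤ u - 1) (by omega : 0 ≤ p.1 - q.1)]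
    · obtain ⟨p, hp, q, hq, hle⟩ := h2
      refine ⟨p, hp, q, hq, ?_⟩
      have a1 := hx p hp q hq
      have a2 := hy p hp q hq
      have b1 : 0 ≤ p.1 - q.1 := by omega
      have b2 : 0 ≤ p.2 - q.2 := by omega
      nlinarith [mul_nonneg (by omega : 0 ≤ u - 1) b1, mul_nonneg (by omega : 0 ≤ v - 1) b2]
  rcases lt_or_gt_of_ne hu with hu | hu
  · obtain ⟨p, hp, q, hq, hle⟩ := key (-u) (-v) (by omega)
    exact ⟨q, hq, p, hp, by linarith⟩
  · exact key u v hu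

/-- The directions with dominating coordinate. -/
lemma crit_off {h : ℤ} (hh : 0 < h) {F : Finset (ℤ × ℤ)}
    (hx : ∀ p ∈ F, ∀ q ∈ F, p.1 - q.1 ≤ h) (hy : ∀ p ∈ F, ∀ q ∈ F, p.2 - q.2 ≤ h)
    (h1 : ∃ p ∈ F, ∃ q ∈ F, h ≤ p.1 - q.1)
    (h2 : ∃ p ∈ F, ∃ q ∈ F, h ≤ p.2 - q.2) (u v : ℤ) (hne : u ≠ v) (hne' : u ≠ -v) :
    ∃ p ∈ F, ∃ q ∈ F, h ≤ u * (p.1 - q.1) + v * (p.2 - q.2) := by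
  rcases lt_or_ge |v| |u| with hlt | hge
  · obtain ⟨p, hp, q, hq, hle⟩ := h1
    have a0 := hx p hp q hq
    have a1 := hy p hp q hq
    have a2 := hy q hq p hp
    have e : p.1 - q.1 = h := by omega
    have habs : |v * (p.2 - q.2)| ≤ |v| * h := by
      rw [abs_mul]
      exact mul_le_mul_of_nonneg_left (abs_le.2 ⟨by omega, a1⟩) (abs_nonneg v)
    have hab := abs_le.1 habs
    have hm : h ≤ (|u| - |v|) * h := by nlinarith
    rcases le_total 0 u with hu | hu
    · refine ⟨p, hp, q, hq, ?_⟩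
      rw [abs_of_nonneg hu] at hm
      rw [e]; linarith [hab.1]
    · refine ⟨q, hq, p, hp, ?_⟩
      rw [abs_of_nonpos hu] at hm
      have e' : q.1 - p.1 = -h := by omega
      have e2 : v * (q.2 - p.2) = -(v * (p.2 - q.2)) := by ring
      rw [e', e2]; linarith [hab.2]
  · have hlt : |u| < |v| := by
      apply lt_of_le_of_ne hge
      intro he
      rcases abs_eq_abs.1 he with h | h
      · exact hne h
      · exact hne' h
    obtain ⟨p, hp, q, hq, hle⟩ := h2
    have a0 := hy p hp q hq
    have a1 := hx p hp q hq
    have a2 := hx q hq p hp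
    have e : p.2 - q.2 = h := by omega
    have habs : |u * (p.1 - q.1)| ≤ |u| * h := by
      rw [abs_mul]
      exact mul_le_mul_of_nonneg_left (abs_le.2 ⟨by omega, a1⟩) (abs_nonneg u)
    have hab := abs_le.1 habs
    have hm : h ≤ (|v| - |u|) * h := by nlinarith
    rcases le_total 0 v with hv | hv
    · refine ⟨p, hp, q, hq, ?_⟩
      rw [abs_of_nonneg hv] at hm
      rw [e]; linarith [hab.1]
    · refine ⟨q, hq, p, hp, ?_⟩
      rw [abs_of_nonpos hv] at hm
      have e' : q.2 - p.2 = -h := by omega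
      have e2 : u * (q.1 - p.1) = -(u * (p.1 - q.1)) := by ring
      rw [e', e2]; linarith [hab.2]

lemma critB {h : ℤ} (hh : 0 < h) {F : Finset (ℤ × ℤ)}
    (hx : ∀ p ∈ F, ∀ q ∈ F, p.1 - q.1 ≤ h) (hy : ∀ p ∈ F, ∀ q ∈ F, p.2 - q.2 ≤ h)
    (h1 : ∃ p ∈ F, ∃ q ∈ F, h ≤ p.1 - q.1)
    (h2 : ∃ p ∈ F, ∃ q ∈ F, h ≤ p.2 - q.2)
    (h3 : ∃ p ∈ F, ∃ q ∈ F, h ≤ (p.1 - q.1) + (p.2 - q.2)) : Crit h F := by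
  refine ⟨1, -1, Or.inl one_ne_zero, ?_⟩
  intro u v huv
  have hu : u ≠ -v := by intro hc; apply huv; rw [hc]; ring
  by_cases huv' : u = v
  · subst huv'
    obtain ⟨p, hp, q, hq, hle⟩ := h3
    have hu0 : u ≠ 0 := by omega
    rcases lt_or_gt_of_ne hu0 with h0 | h0
    · exact ⟨q, hq, p, hp, by nlinarith⟩
    · exact ⟨p, hp, q, hq, by nlinarith⟩
  · exact crit_off hh hx hy h1 h2 u v huv' hu

lemma critC {h : ℤ} (hh : 0 < h) {F : Finset (ℤ × ℤ)}
    (hx : ∀ p ∈ F, ∀ q ∈ F, p.1 - q.1 ≤ h) (hy : ∀ p ∈ F, ∀ q ∈ F, p.2 - q.2 ≤ h)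
    (h1 : ∃ p ∈ F, ∃ q ∈ F, h ≤ p.1 - q.1)
    (h2 : ∃ p ∈ F, ∃ q ∈ F, h ≤ p.2 - q.2)
    (h3 : ∃ p ∈ F, ∃ q ∈ F, h ≤ (p.1 - q.1) - (p.2 - q.2)) : Crit h F := by
  refine ⟨1, 1, Or.inl one_ne_zero, ?_⟩
  intro u v huv
  have hu : u ≠ v := by intro hc; apply huv; rw [hc]
  by_cases huv' : u = -v
  · subst huv'
    obtain ⟨p, hp, q, hq, hle⟩ := h3
    have hu0 : v ≠ 0 := by omega
    rcases lt_or_gt_of_ne hu0 with h0 | h0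
    · exact ⟨p, hp, q, hq, by nlinarith⟩
    · exact ⟨q, hq, p, hp, by nlinarith⟩
  · exact crit_off hh hx hy h1 h2 u v hu huv'

lemma seg0 {h : ℤ} (hh : 0 < h) {P : Set (Fin 2 → ℝ)} (hP : Minl h P)
    (h0 : pt (0, 0) ∈ P) (h1 : pt (h, 0) ∈ P) : Concl h P := by
  have hcr : Crit h ({(0, 0), (h, 0)} : Finset (ℤ × ℤ)) := by
    apply critA hh
    · simp only [Finset.mem_insert, Finset.mem_singleton]
      rintro p (rfl | rfl) q (rfl | rfl) <;> dsimp only <;> omega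
    · simp only [Finset.mem_insert, Finset.mem_singleton]
      rintro p (rfl | rfl) q (rfl | rfl) <;> dsimp only <;> omega
    · exact ⟨(h, 0), by simp, (0, 0), by simp, by simp⟩
    · exact ⟨(h, 0), by simp, (0, 0), by simp, by simp⟩
    · exact ⟨(h, 0), by simp, (0, 0), by simp, by simp⟩
  have hEq := hP.eq_hull hh (by simp) (by
    simp only [Finset.mem_insert, Finset.mem_singleton]
    rintro p (rfl | rfl) <;> assumption) hcr
  left
  rw [hEq]
  convert LE.refl' _ using 2
  simp [Set.image_insert_eq, pt]

lemma tri {h : ℤ} (hh : 0 < h) {P : Set (Fin 2 → ℝ)} (hP : Minl h P) {a b : ℤ}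
    (h0 : pt (0, 0) ∈ P) (h1 : pt (a, h) ∈ P) (h2 : pt (h, b) ∈ P)
    (ha : 1 ≤ a) (ha' : a ≤ h - 1) (hb : 1 ≤ b) (hb' : b ≤ h - 1) : Concl h P := by
  by_cases hab : h ≤ a + b
  · have hcr : Crit h ({(0, 0), (a, h), (h, b)} : Finset (ℤ × ℤ)) := by
      apply critB hh
      · simp only [Finset.mem_insert, Finset.mem_singleton]
        rintro p (rfl | rfl | rfl) q (rfl | rfl | rfl) <;> dsimp only <;> omega
      · simp only [Finset.mem_insert, Finset.mem_singleton]
        rintro p (rfl | rfl | rfl) q (rfl | rfl | rfl) <;> dsimp only <;> omega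
      · exact ⟨(h, b), by simp, (0, 0), by simp, by simp⟩
      · exact ⟨(a, h), by simp, (0, 0), by simp, by simp⟩
      · exact ⟨(a, h), by simp, (0, 0), by simp, by dsimp only; omega⟩
    have hEq := hP.eq_hull hh (by simp) (by
      simp only [Finset.mem_insert, Finset.mem_singleton]
      rintro p (rfl | rfl | rfl) <;> assumption) hcr
    right; left
    refine ⟨a, b, ha, ha', hb, hb', hab, ?_⟩
    rw [hEq]
    convert LE.refl' _ using 2
    simp [Set.image_insert_eq, pt]
  · exfalso
    have h3 : pt (a, h - 1) ∈ P := by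
      apply vert hP.convex hh h0 h2 h1 (by omega) (by omega)
      left
      refine ⟨by omega, ?_⟩
      nlinarith
    have hcr : Crit h ({(0, 0), (a, h - 1), (h, b)} : Finset (ℤ × ℤ)) := by
      apply critA hh
      · simp only [Finset.mem_insert, Finset.mem_singleton]
        rintro p (rfl | rfl | rfl) q (rfl | rfl | rfl) <;> dsimp only <;> omega
      · simp only [Finset.mem_insert, Finset.mem_singleton]
        rintro p (rfl | rfl | rfl) q (rfl | rfl | rfl) <;> dsimp only <;> omega
      · exact ⟨(h, b), by simp, (0, 0), by simp, by simp⟩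
      · exact ⟨(h, b), by simp, (0, 0), by simp, by dsimp only; omega⟩
      · exact ⟨(h, b), by simp, (a, h - 1), by simp, by dsimp only; omega⟩
    have hEq := hP.eq_hull hh (by simp) (by
      simp only [Finset.mem_insert, Finset.mem_singleton]
      rintro p (rfl | rfl | rfl) <;> assumption) hcr
    have hle := hull_le (F := (({(0, 0), (a, h - 1), (h, b)} : Finset (ℤ × ℤ)) : Set (ℤ × ℤ)))
      0 1 (h - 1) (by
        simp only [Finset.coe_insert, Finset.coe_singleton, Set.mem_insert_iff,
          Set.mem_singleton_iff]
        rintro p (rfl | rfl | rfl) <;> dsimp only <;> omega) (pt (a, h)) (by rw [← hEq]; exact h1)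
    simp at hle
    linarith

lemma corner {h : ℤ} (hh : 0 < h) {P : Set (Fin 2 → ℝ)} (hP : Minl h P) {a b : ℤ}
    (h0 : pt (0, 0) ∈ P) (h1 : pt (a, h) ∈ P) (h2 : pt (h, b) ∈ P)
    (ha : 0 ≤ a) (ha' : a ≤ h) (hb : 0 ≤ b) (hb' : b ≤ h) : Concl h P := by
  have diag : pt (h, h) ∈ P → Concl h P := by
    intro hd
    have hu : IsUnimodularMap (aff 1 0 (-1) 1 0 0) := aff_uni _ _ (by norm_num)
    exact Concl.of_image hu (seg0 hh (hP.image hu) (img h0 (by simp) (by simp))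
      (img hd (by simp) (by simp)))
  rcases eq_or_lt_of_le ha with rfl | ha1
  · have hu : IsUnimodularMap (aff 0 1 1 0 0 0) := aff_uni _ _ (by norm_num)
    exact Concl.of_image hu (seg0 hh (hP.image hu) (img h0 (by simp) (by simp))
      (img h1 (by simp) (by simp)))
  rcases eq_or_lt_of_le hb with rfl | hb1
  · exact seg0 hh hP h0 h2
  rcases eq_or_lt_of_le ha' with rfl | ha2
  · exact diag h1
  rcases eq_or_lt_of_le hb' with rfl | hb2
  · exact diag h2
  exact tri hh hP h0 h1 h2 (by omega) (by omega) (by omega) (by omega)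

lemma quad {h : ℤ} (hh : 0 < h) {P : Set (Fin 2 → ℝ)} (hP : Minl h P) {B L R T : ℤ}
    (h0 : pt (B, 0) ∈ P) (h1 : pt (0, L) ∈ P) (h2 : pt (h, R) ∈ P) (h3 : pt (T, h) ∈ P)
    (hB : 1 ≤ B) (hB' : B ≤ h - 1) (hL : 1 ≤ L) (hL' : L ≤ h - 1)
    (hR : 1 ≤ R) (hR' : R ≤ h - 1) (hT : 1 ≤ T) (hT' : T ≤ h - 1)
    (hm : h < min B L + min (h - R) (h - T)) : Concl h P := by
  have hcr : Crit h ({(B, 0), (0, L), (h, R), (T, h)} : Finset (ℤ × ℤ)) := by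
    apply critC hh
    · simp only [Finset.mem_insert, Finset.mem_singleton]
      rintro p (rfl | rfl | rfl | rfl) q (rfl | rfl | rfl | rfl) <;> dsimp only <;> omega
    · simp only [Finset.mem_insert, Finset.mem_singleton]
      rintro p (rfl | rfl | rfl | rfl) q (rfl | rfl | rfl | rfl) <;> dsimp only <;> omega
    · exact ⟨(h, R), by simp, (0, L), by simp, by simp⟩
    · exact ⟨(T, h), by simp, (B, 0), by simp, by simp⟩
    · exact ⟨(B, 0), by simp, (T, h), by simp, by dsimp only; omega⟩
  have hEq := hP.eq_hull hh (by simp) (by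
    simp only [Finset.mem_insert, Finset.mem_singleton]
    rintro p (rfl | rfl | rfl | rfl) <;> assumption) hcr
  right; right
  refine ⟨B, L, h - R, h - T, hB, hB', hL, hL', by omega, by omega, by omega, by omega, hm, ?_⟩
  rw [hEq]
  convert LE.refl' _ using 2
  simp [Set.image_insert_eq, pt]

lemma cutB {h : ℤ} (hh : 0 < h) {P : Set (Fin 2 → ℝ)} (hP : Minl h P) {B L R T : ℤ}
    (h0 : pt (B, 0) ∈ P) (h1 : pt (0, L) ∈ P) (h2 : pt (h, R) ∈ P) (h3 : pt (T, h) ∈ P)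
    (hB : 1 ≤ B) (hB' : B ≤ h - 1) (hL : 1 ≤ L) (hL' : L ≤ h - 1)
    (hR : 1 ≤ R) (hR' : R ≤ h - 1) (hT : 1 ≤ T) (hT' : T ≤ h - 1)
    (c1 : B + 1 ≤ R ∨ B + 1 ≤ T ∨ L ≤ R ∨ L ≤ T)
    (c2 : h - L ≤ B - 1 ∨ T ≤ B - 1 ∨ R ≤ L ∨ T ≤ h - R) : False := by
  have h4 : pt (B, 1) ∈ P := by
    apply vert hP.convex hh h1 h2 h0 (by omega) (by omega)
    right
    refine ⟨by omega, ?_⟩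
    nlinarith [mul_nonneg (by omega : 0 ≤ h - B) (by omega : 0 ≤ L - 1),
      mul_nonneg (by omega : 0 ≤ B) (by omega : 0 ≤ R - 1)]
  have hcr : Crit h ({(B, 1), (0, L), (h, R), (T, h)} : Finset (ℤ × ℤ)) := by
    apply critA hh
    · simp only [Finset.mem_insert, Finset.mem_singleton]
      rintro p (rfl | rfl | rfl | rfl) q (rfl | rfl | rfl | rfl) <;> dsimp only <;> omega
    · simp only [Finset.mem_insert, Finset.mem_singleton]
      rintro p (rfl | rfl | rfl | rfl) q (rfl | rfl | rfl | rfl) <;> dsimp only <;> omega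
    · exact ⟨(h, R), by simp, (0, L), by simp, by simp⟩
    · rcases c1 with c | c | c | c
      · exact ⟨(h, R), by simp, (B, 1), by simp, by dsimp only; omega⟩
      · exact ⟨(T, h), by simp, (B, 1), by simp, by dsimp only; omega⟩
      · exact ⟨(h, R), by simp, (0, L), by simp, by dsimp only; omega⟩
      · exact ⟨(T, h), by simp, (0, L), by simp, by dsimp only; omega⟩
    · rcases c2 with c | c | c | c
      · exact ⟨(B, 1), by simp, (0, L), by simp, by dsimp only; omega⟩
      · exact ⟨(B, 1), by simp, (T, h), by simp, by dsimp only; omega⟩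
      · exact ⟨(h, R), by simp, (0, L), by simp, by dsimp only; omega⟩
      · exact ⟨(h, R), by simp, (T, h), by simp, by dsimp only; omega⟩
  have hEq := hP.eq_hull hh (by simp) (by
    simp only [Finset.mem_insert, Finset.mem_singleton]
    rintro p (rfl | rfl | rfl | rfl) <;> assumption) hcr
  have hle := hull_le
    (F := (({(B, 1), (0, L), (h, R), (T, h)} : Finset (ℤ × ℤ)) : Set (ℤ × ℤ)))
    0 (-1) (-1) (by
      simp only [Finset.coe_insert, Finset.coe_singleton, Set.mem_insert_iff,
        Set.mem_singleton_iff]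
      rintro p (rfl | rfl | rfl | rfl) <;> dsimp only <;> omega) (pt (B, 0))
    (by rw [← hEq]; exact h0)
  simp at hle
  linarith

lemma noCorner {h : ℤ} (hh : 0 < h) {P : Set (Fin 2 → ℝ)} (hP : Minl h P) {B L R T : ℤ}
    (h0 : pt (B, 0) ∈ P) (h1 : pt (0, L) ∈ P) (h2 : pt (h, R) ∈ P) (h3 : pt (T, h) ∈ P)
    (hB : 1 ≤ B) (hB' : B ≤ h - 1) (hL : 1 ≤ L) (hL' : L ≤ h - 1)
    (hR : 1 ≤ R) (hR' : R ≤ h - 1) (hT : 1 ≤ T) (hT' : T ≤ h - 1) : Concl h P := by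
  by_cases q1 : h < min B L + min (h - R) (h - T)
  · exact quad hh hP h0 h1 h2 h3 hB hB' hL hL' hR hR' hT hT' q1
  by_cases q2 : h < min (h - B) R + min (h - L) T
  · have hu : IsUnimodularMap (aff (-1) 0 0 1 h 0) := aff_uni _ _ (by norm_num)
    apply Concl.of_image hu
    refine quad hh (hP.image hu) (B := h - B) (L := R) (R := L) (T := h - T)
      (img h0 (by dsimp only; ring) (by dsimp only; ring))
      (img h2 (by dsimp only; ring) (by dsimp only; ring))
      (img h1 (by dsimp only; ring) (by dsimp only; ring))
      (img h3 (by dsimp only; ring) (by dsimp only; ring)) ?_ ?_ ?_ ?_ ?_ ?_ ?_ ?_ ?_ <;> omega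
  exfalso
  have k1 : ¬ ((B + 1 ≤ R ∨ B + 1 ≤ T ∨ L ≤ R ∨ L ≤ T) ∧
      (h - L ≤ B - 1 ∨ T ≤ B - 1 ∨ R ≤ L ∨ T ≤ h - R)) := fun c =>
    cutB hh hP h0 h1 h2 h3 hB hB' hL hL' hR hR' hT hT' c.1 c.2
  have k2 : ¬ ((T + 1 ≤ h - R ∨ T + 1 ≤ B ∨ h - L ≤ h - R ∨ h - L ≤ B) ∧
      (h - (h - L) ≤ T - 1 ∨ B ≤ T - 1 ∨ h - R ≤ h - L ∨ B ≤ h - (h - R))) := by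
    rintro ⟨c1, c2⟩
    have hu : IsUnimodularMap (aff 1 0 0 (-1) 0 h) := aff_uni _ _ (by norm_num)
    refine cutB hh (hP.image hu) (B := T) (L := h - L) (R := h - R) (T := B)
      (img h3 (by dsimp only; ring) (by dsimp only; ring))
      (img h1 (by dsimp only; ring) (by dsimp only; ring))
      (img h2 (by dsimp only; ring) (by dsimp only; ring))
      (img h0 (by dsimp only; ring) (by dsimp only; ring)) ?_ ?_ ?_ ?_ ?_ ?_ ?_ ?_ c1 c2 <;> omega
  have k3 : ¬ ((L + 1 ≤ T ∨ L + 1 ≤ R ∨ B ≤ T ∨ B ≤ R) ∧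
      (h - B ≤ L - 1 ∨ R ≤ L - 1 ∨ T ≤ B ∨ R ≤ h - T)) := by
    rintro ⟨c1, c2⟩
    have hu : IsUnimodularMap (aff 0 1 1 0 0 0) := aff_uni _ _ (by norm_num)
    refine cutB hh (hP.image hu) (B := L) (L := B) (R := T) (T := R)
      (img h1 (by dsimp only; ring) (by dsimp only; ring))
      (img h0 (by dsimp only; ring) (by dsimp only; ring))
      (img h3 (by dsimp only; ring) (by dsimp only; ring))
      (img h2 (by dsimp only; ring) (by dsimp only; ring)) ?_ ?_ ?_ ?_ ?_ ?_ ?_ ?_ c1 c2 <;> omega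
  have k4 : ¬ ((R + 1 ≤ h - T ∨ R + 1 ≤ L ∨ h - B ≤ h - T ∨ h - B ≤ L) ∧
      (h - (h - B) ≤ R - 1 ∨ L ≤ R - 1 ∨ h - T ≤ h - B ∨ L ≤ h - (h - T))) := by
    rintro ⟨c1, c2⟩
    have hu : IsUnimodularMap (aff 0 1 (-1) 0 0 h) := aff_uni _ _ (by norm_num)
    refine cutB hh (hP.image hu) (B := R) (L := h - B) (R := h - T) (T := L)
      (img h2 (by dsimp only; ring) (by dsimp only; ring))
      (img h0 (by dsimp only; ring) (by dsimp only; ring))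
      (img h3 (by dsimp only; ring) (by dsimp only; ring))
      (img h1 (by dsimp only; ring) (by dsimp only; ring)) ?_ ?_ ?_ ?_ ?_ ?_ ?_ ?_ c1 c2 <;> omega
  omega

lemma square {h : ℤ} (hh : 0 < h) {P : Set (Fin 2 → ℝ)} (hP : Minl h P) {B L R T : ℤ}
    (h0 : pt (B, 0) ∈ P) (h1 : pt (0, L) ∈ P) (h2 : pt (h, R) ∈ P) (h3 : pt (T, h) ∈ P)
    (hB : 0 ≤ B) (hB' : B ≤ h) (hL : 0 ≤ L) (hL' : L ≤ h)
    (hR : 0 ≤ R) (hR' : R ≤ h) (hT : 0 ≤ T) (hT' : T ≤ h) : Concl h P := by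
  have c00 : pt (0, 0) ∈ P → Concl h P := fun hc =>
    corner hh hP hc h3 h2 hT hT' hR hR'
  have c10 : pt (h, 0) ∈ P → Concl h P := by
    intro hc
    have hu : IsUnimodularMap (aff (-1) 0 0 1 h 0) := aff_uni _ _ (by norm_num)
    apply Concl.of_image hu
    refine corner hh (hP.image hu) (a := h - T) (b := L)
      (img hc (by dsimp only; ring) (by dsimp only; ring))
      (img h3 (by dsimp only; ring) (by dsimp only; ring))
      (img h1 (by dsimp only; ring) (by dsimp only; ring)) ?_ ?_ ?_ ?_ <;> omega
  have c01 : pt (0, h) ∈ P → Concl h P := by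
    intro hc
    have hu : IsUnimodularMap (aff 1 0 0 (-1) 0 h) := aff_uni _ _ (by norm_num)
    apply Concl.of_image hu
    refine corner hh (hP.image hu) (a := B) (b := h - R)
      (img hc (by dsimp only; ring) (by dsimp only; ring))
      (img h0 (by dsimp only; ring) (by dsimp only; ring))
      (img h2 (by dsimp only; ring) (by dsimp only; ring)) ?_ ?_ ?_ ?_ <;> omega
  have c11 : pt (h, h) ∈ P → Concl h P := by
    intro hc
    have hu : IsUnimodularMap (aff (-1) 0 0 (-1) h h) := aff_uni _ _ (by norm_num)
    apply Concl.of_image hu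
    refine corner hh (hP.image hu) (a := h - B) (b := h - L)
      (img hc (by dsimp only; ring) (by dsimp only; ring))
      (img h0 (by dsimp only; ring) (by dsimp only; ring))
      (img h1 (by dsimp only; ring) (by dsimp only; ring)) ?_ ?_ ?_ ?_ <;> omega
  by_cases b0 : B = 0
  · exact c00 (b0 ▸ h0)
  by_cases b1 : B = h
  · exact c10 (b1 ▸ h0)
  by_cases l0 : L = 0
  · exact c00 (l0 ▸ h1)
  by_cases l1 : L = h
  · exact c01 (l1 ▸ h1)
  by_cases r0 : R = 0
  · exact c10 (r0 ▸ h2)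
  by_cases r1 : R = h
  · rw [r1] at h2; exact c11 h2
  by_cases t0 : T = 0
  · exact c01 (t0 ▸ h3)
  by_cases t1 : T = h
  · rw [t1] at h3; exact c11 h3
  apply noCorner hh hP h0 h1 h2 h3 <;> omega

/-- Both coordinate widths are equal to `h`. -/
lemma caseTwo {h : ℤ} (hh : 0 < h) {P : Set (Fin 2 → ℝ)} (hP : Minl h P) {p q m s1 s2 : ℤ}
    (hx : ∀ x ∈ P, 0 ≤ x 0 ∧ x 0 ≤ h) (hy : ∀ x ∈ P, (m : ℝ) ≤ x 1 ∧ x 1 ≤ m + h)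
    (h0 : pt (0, p) ∈ P) (h1 : pt (h, q) ∈ P) (h2 : pt (s1, m) ∈ P)
    (h3 : pt (s2, m + h) ∈ P) : Concl h P := by
  have hu : IsUnimodularMap (aff 1 0 0 1 0 (-m)) := aff_uni _ _ (by norm_num)
  apply Concl.of_image hu
  have hxi : ∀ z : ℤ × ℤ, pt z ∈ P → 0 ≤ z.1 ∧ z.1 ≤ h := by
    intro z hz
    have := hx _ hz
    simp only [pt_zero] at this
    exact_mod_cast this
  have hyi : ∀ z : ℤ × ℤ, pt z ∈ P → m ≤ z.2 ∧ z.2 ≤ m + h := by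
    intro z hz
    have := hy _ hz
    simp only [pt_one] at this
    exact_mod_cast this
  have a1 := hyi _ h0
  have a2 := hyi _ h1
  have a3 := hxi _ h2
  have a4 := hxi _ h3
  dsimp only at a1 a2 a3 a4
  refine square hh (hP.image hu) (B := s1) (L := p - m) (R := q - m) (T := s2)
    (img h2 (by dsimp only; ring) (by dsimp only; ring))
    (img h0 (by dsimp only; ring) (by dsimp only; ring))
    (img h1 (by dsimp only; ring) (by dsimp only; ring))
    (img h3 (by dsimp only; ring) (by dsimp only; ring)) ?_ ?_ ?_ ?_ ?_ ?_ ?_ ?_ <;> omega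

lemma box_int {h : ℤ} {P : Set (Fin 2 → ℝ)}
    (hb : ∀ x ∈ P, 0 ≤ x 0 ∧ x 0 ≤ h ∧ 0 ≤ x 1 ∧ x 1 ≤ h) (z : ℤ × ℤ) (hz : pt z ∈ P) :
    0 ≤ z.1 ∧ z.1 ≤ h ∧ 0 ≤ z.2 ∧ z.2 ≤ h := by
  have := hb _ hz
  simp only [pt_one, pt_zero] at this
  exact_mod_cast this

lemma cutDiag {h : ℤ} (hh : 0 < h) {P : Set (Fin 2 → ℝ)} (hP : Minl h P) {p q : ℤ}
    (hb : ∀ x ∈ P, 0 ≤ x 0 ∧ x 0 ≤ h ∧ 0 ≤ x 1 ∧ x 1 ≤ h)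
    (h0 : pt (0, p) ∈ P) (h1 : pt (h, q) ∈ P) (hpq : p ≤ q) {s r s' r' : ℤ}
    (h2 : pt (s, r) ∈ P) (h3 : pt (s', r') ∈ P) (hw : h + 1 ≤ (s - r) - (s' - r')) :
    -p ≤ s' - r' := by
  by_contra hcon
  have b0 := box_int hb _ h0
  have b1 := box_int hb _ h1
  have b2 := box_int hb _ h2
  have b3 := box_int hb _ h3
  dsimp only at b0 b1 b2 b3
  have h4 : pt (s', r' - 1) ∈ P := by
    apply vert hP.convex hh h0 h1 h3 (by omega) (by omega)
    left
    refine ⟨by omega, ?_⟩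
    nlinarith [mul_nonneg (by omega : 0 ≤ s') (by omega : 0 ≤ h - (q - p)),
      mul_nonneg (by omega : 0 ≤ h) (by omega : 0 ≤ r' - 1 - s' - p)]
  have hcr : Crit h ({(0, p), (h, q), (s, r), (s', r' - 1)} : Finset (ℤ × ℤ)) := by
    apply critA hh
    · simp only [Finset.mem_insert, Finset.mem_singleton]
      rintro p (rfl | rfl | rfl | rfl) q (rfl | rfl | rfl | rfl) <;> dsimp only <;> omega
    · simp only [Finset.mem_insert, Finset.mem_singleton]
      rintro p (rfl | rfl | rfl | rfl) q (rfl | rfl | rfl | rfl) <;> dsimp only <;> omega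
    · exact ⟨(h, q), by simp, (0, p), by simp, by simp⟩
    · exact ⟨(h, q), by simp, (0, p), by simp, by dsimp only; omega⟩
    · exact ⟨(s, r), by simp, (s', r' - 1), by simp, by dsimp only; omega⟩
  have hEq := hP.eq_hull hh (by simp) (by
    simp only [Finset.mem_insert, Finset.mem_singleton]
    rintro p (rfl | rfl | rfl | rfl) <;> assumption) hcr
  have hle := hull_le
    (F := (({(0, p), (h, q), (s, r), (s', r' - 1)} : Finset (ℤ × ℤ)) : Set (ℤ × ℤ)))
    (-1) 1 (r' - s' - 1) (by
      simp only [Finset.coe_insert, Finset.coe_singleton, Set.mem_insert_iff,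
        Set.mem_singleton_iff]
      rintro p (rfl | rfl | rfl | rfl) <;> dsimp only <;> omega) (pt (s', r'))
    (by rw [← hEq]; exact h3)
  simp at hle
  linarith

lemma narrow {h : ℤ} (hh : 0 < h) {P : Set (Fin 2 → ℝ)} (hP : Minl h P) {p q : ℤ}
    (hb : ∀ x ∈ P, 0 ≤ x 0 ∧ x 0 ≤ h ∧ 0 ≤ x 1 ∧ x 1 ≤ h)
    (h0 : pt (0, p) ∈ P) (h1 : pt (h, q) ∈ P) (hpq : p < q)
    (hw : ∀ z w : ℤ × ℤ, pt z ∈ P → pt w ∈ P → z.2 - w.2 ≤ h - 1) : Concl h P := by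
  obtain ⟨⟨s, r⟩, hz, hzm⟩ := exists_ext hP.1 1 (-1)
  obtain ⟨⟨s', r'⟩, hz', hzm'⟩ := exists_ext hP.1 (-1) 1
  have hge : h ≤ (s - r) - (s' - r') := by
    rcases hP.lower 1 (-1) 0 1 (by norm_num) with ⟨a, b, ha, hb', hab⟩ | ⟨a, b, ha, hb', hab⟩
    · have e1 := hzm _ ha
      have e2 := hzm' _ hb'
      simp only [pt_zero, pt_one] at e1 e2
      norm_cast at e1 e2
      omega
    · have := hw a b ha hb'
      omega
  rcases eq_or_lt_of_le hge with heq | hlt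
  · have hu : IsUnimodularMap (aff 1 0 1 (-1) 0 0) := aff_uni _ _ (by norm_num)
    apply Concl.of_image hu
    refine caseTwo hh (hP.image hu) (p := -p) (q := h - q) (m := s' - r') (s1 := s') (s2 := s)
      ?_ ?_
      (img h0 (by dsimp only; ring) (by dsimp only; ring))
      (img h1 (by dsimp only; ring) (by dsimp only; ring))
      (img hz' (by dsimp only; ring) (by dsimp only; ring))
      (img hz (by dsimp only; ring) (by dsimp only; omega))
    · rintro _ ⟨x, hx, rfl⟩
      have := hb x hx
      simp
      exact ⟨this.1, this.2.1⟩
    · rintro _ ⟨x, hx, rfl⟩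
      have e1 := hzm x hx
      have e2 := hzm' x hx
      have e3 : (h : ℝ) = (s - r) - (s' - r') := by exact_mod_cast heq
      push_cast at e1 e2
      rw [aff_one]
      push_cast
      constructor <;> linarith
  · exfalso
    have k1 := cutDiag hh hP hb h0 h1 hpq.le hz hz' (by omega)
    have hu : IsUnimodularMap (aff (-1) 0 0 (-1) h h) := aff_uni _ _ (by norm_num)
    have k2 := cutDiag hh (hP.image hu) (p := h - q) (q := h - p)
      (s := h - s') (r := h - r') (s' := h - s) (r' := h - r)
      (by
        rintro _ ⟨x, hx, rfl⟩
        have := hb x hx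
        simp only [aff_zero, aff_one]
        push_cast
        refine ⟨?_, ?_, ?_, ?_⟩ <;> linarith)
      (img h1 (by dsimp only; ring) (by dsimp only; ring))
      (img h0 (by dsimp only; ring) (by dsimp only; ring)) (by omega)
      (img hz' (by dsimp only; ring) (by dsimp only; ring))
      (img hz (by dsimp only; ring) (by dsimp only; ring)) (by omega)
    omega

/-- The polygon lies in the box and has horizontal width `h`. -/
lemma horiz {h : ℤ} (hh : 0 < h) {P : Set (Fin 2 → ℝ)} (hP : Minl h P) {p q : ℤ}
    (hb : ∀ x ∈ P, 0 ≤ x 0 ∧ x 0 ≤ h ∧ 0 ≤ x 1 ∧ x 1 ≤ h)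
    (h0 : pt (0, p) ∈ P) (h1 : pt (h, q) ∈ P) : Concl h P := by
  by_cases hw : ∀ z w : ℤ × ℤ, pt z ∈ P → pt w ∈ P → z.2 - w.2 ≤ h - 1
  · rcases lt_trichotomy p q with hpq | rfl | hpq
    · exact narrow hh hP hb h0 h1 hpq hw
    · have hu : IsUnimodularMap (aff 1 0 0 1 0 (-p)) := aff_uni _ _ (by norm_num)
      apply Concl.of_image hu
      exact seg0 hh (hP.image hu) (img h0 (by dsimp only; ring) (by dsimp only; ring))
        (img h1 (by dsimp only; ring) (by dsimp only; ring))
    · have hu : IsUnimodularMap (aff (-1) 0 0 1 h 0) := aff_uni _ _ (by norm_num)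
      apply Concl.of_image hu
      refine narrow hh (hP.image hu) (p := q) (q := p) ?_
        (img h1 (by dsimp only; ring) (by dsimp only; ring))
        (img h0 (by dsimp only; ring) (by dsimp only; ring)) hpq ?_
      · rintro _ ⟨x, hx, rfl⟩
        have := hb x hx
        simp only [aff_zero, aff_one]
        push_cast
        refine ⟨?_, ?_, ?_, ?_⟩ <;> linarith
      · rintro z w ⟨x, hx, hxz⟩ ⟨y, hy, hyw⟩
        have l1 : x = pt (h - z.1, z.2) := by
          have a0 := congrFun hxz 0
          have a1 := congrFun hxz 1
          simp at a0 a1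
          apply vec_ext <;> simp <;> linarith
        have l2 : y = pt (h - w.1, w.2) := by
          have a0 := congrFun hyw 0
          have a1 := congrFun hyw 1
          simp at a0 a1
          apply vec_ext <;> simp <;> linarith
        exact hw (h - z.1, z.2) (h - w.1, w.2) (l1 ▸ hx) (l2 ▸ hy)
  · push Not at hw
    obtain ⟨⟨z1, z2⟩, ⟨w1, w2⟩, hz, hw, hzw⟩ := hw
    have b1 := box_int hb _ hz
    have b2 := box_int hb _ hw
    dsimp only at b1 b2 hzw
    have e1 : z2 = 0 + h := by omega
    have e2 : w2 = 0 := by omega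
    subst e1 e2
    refine caseTwo hh hP (m := 0) (fun x hx => ⟨(hb x hx).1, (hb x hx).2.1⟩) ?_ h0 h1 hw hz
    intro x hx
    have := hb x hx
    push_cast
    constructor <;> linarith

lemma main {h : ℤ} (hh : 0 < h) {P : Set (Fin 2 → ℝ)} (hP : Minl h P) : Concl h P := by
  obtain ⟨φ, hφ, hb⟩ := hP.exists_box hh
  apply Concl.of_image hφ
  have hQ := hP.image hφ
  generalize φ '' P = Q at hb hQ
  rcases hQ.lower 1 0 0 1 (by norm_num) with
    ⟨⟨z1, z2⟩, ⟨w1, w2⟩, hz, hw, hzw⟩ | ⟨⟨z1, z2⟩, ⟨w1, w2⟩, hz, hw, hzw⟩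
  · have b1 := box_int hb _ hz
    have b2 := box_int hb _ hw
    dsimp only at b1 b2 hzw
    have e1 : z1 = h := by omega
    have e2 : w1 = 0 := by omega
    subst e1 e2
    exact horiz hh hQ hb hw hz
  · have b1 := box_int hb _ hz
    have b2 := box_int hb _ hw
    dsimp only at b1 b2 hzw
    have e1 : z2 = h := by omega
    have e2 : w2 = 0 := by omega
    subst e1 e2
    have hu : IsUnimodularMap (aff 0 1 1 0 0 0) := aff_uni _ _ (by norm_num)
    apply Concl.of_image hu
    refine horiz hh (hQ.image hu) (p := w1) (q := z1) ?_
      (img hw (by dsimp only; ring) (by dsimp only; ring))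
      (img hz (by dsimp only; ring) (by dsimp only; ring))
    rintro _ ⟨x, hx, rfl⟩
    have := hb x hx
    simp only [aff_zero, aff_one]
    push_cast
    refine ⟨?_, ?_, ?_, ?_⟩ <;> linarith

/-- Classification of minimal lattice polygons of lattice size `h`: every minimal
lattice polygon `P` with `ls_□(P) = h` is lattice-equivalent to the segment
`[(0,0),(h,0)]`, to a triangle `conv{(0,0),(a,h),(h,b)}` with `1 ≤ a,b ≤ h-1` and
`a+b ≥ h`, or to a quadrilateral `conv{(a,0),(0,b),(h,h-c),(h-d,h)}` with
`1 ≤ a,b,c,d ≤ h-1` and `min{a,b}+min{c,d} > h`. -/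
theorem stmt17 (h : ℤ) (hh : 0 < h) (P : Set (Fin 2 → ℝ)) (hP : IsLatticePolygon P)
    (hls : lsSquare P = (h : ℝ))
    (hmin : ∀ P' : Set (Fin 2 → ℝ), IsLatticePolygon P' → P' ⊂ P →
      lsSquare P' ≠ (h : ℝ)) :
    LatticeEquivalent P (convexHull ℝ {(![0, 0] : Fin 2 → ℝ), ![(h : ℝ), 0]}) ∨
    (∃ a b : ℤ, 1 ≤ a ∧ a ≤ h - 1 ∧ 1 ≤ b ∧ b ≤ h - 1 ∧ h ≤ a + b ∧
      LatticeEquivalent P (convexHull ℝ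
        {(![0, 0] : Fin 2 → ℝ), ![(a : ℝ), (h : ℝ)], ![(h : ℝ), (b : ℝ)]})) ∨
    (∃ a b c d : ℤ, 1 ≤ a ∧ a ≤ h - 1 ∧ 1 ≤ b ∧ b ≤ h - 1 ∧
      1 ≤ c ∧ c ≤ h - 1 ∧ 1 ≤ d ∧ d ≤ h - 1 ∧ h < min a b + min c d ∧
      LatticeEquivalent P (convexHull ℝ
        {(![(a : ℝ), 0] : Fin 2 → ℝ), ![0, (b : ℝ)],
          ![(h : ℝ), ((h - c : ℤ) : ℝ)], ![((h - d : ℤ) : ℝ), (h : ℝ)]})) := by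
  exact main hh ⟨hP, hls, hmin⟩
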